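/- arXiv:1902.11281 — 2 statements merged into one kernel-verified Lean document; each statement's English description precedes it below -/
import Mathlib

section
/- Let n, m, d be positive integers with d ≤ n, let C, A_1, …, A_m be real n×n matrices, let b_1, …, b_m ∈ ℝ, and let each relation ⊲_i be one of ≤, ≥, =. Consider the semidefinite program SDP(I): minimize ⟨C, X⟩ over real symmetric n×n matrices X subject to ⟨A_i, X⟩ ⊲_i b_i for all 1 ≤ i ≤ m, tr(X) ≤ d, and 0 ⪯ X ⪯ I_n, and suppose the feasible set is nonempty and the optimum is attained. Then any extreme point X of the set of optimal solutions of SDP(I) has at most √(2m + 9/4) − 1/2 eigenvalues lying strictly between 0 and 1; in particular, the number of such fractional eigenvalues is at most ⌊√(2m)⌋ + 1. -/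
open Matrix

/-- A positive semidefinite diagonal matrix stays positive semidefinite under small symmetric
perturbations supported on its positive diagonal entries. -/
theorem Matrix.exists_posSemidef_diagonal_add_smul {ι : Type*} [Fintype ι] [DecidableEq ι]
    {v : ι → ℝ} (hv : ∀ i, 0 ≤ v i) {M : Matrix ι ι ℝ} (hM : M.IsSymm)
    (hsupp : ∀ i j, M i j ≠ 0 → 0 < v i) :
    ∃ ε > 0, ∀ t : ℝ, |t| ≤ ε → (diagonal v + t • M).PosSemidef := by
  set c : ι → ι → ℝ := fun i j => |M i j| * ((v i)⁻¹ + (v j)⁻¹) with hc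
  have hc0 : ∀ i j, 0 ≤ c i j := fun i j =>
    mul_nonneg (abs_nonneg _) (add_nonneg (inv_nonneg.2 (hv i)) (inv_nonneg.2 (hv j)))
  have hK : 0 ≤ ∑ i, ∑ j, c i j :=
    Finset.sum_nonneg fun i _ => Finset.sum_nonneg fun j _ => hc0 i j
  set K := ∑ i, ∑ j, c i j with hKdef
  refine ⟨(K + 1)⁻¹, by positivity, fun t ht => ?_⟩
  refine PosSemidef.of_dotProduct_mulVec_nonneg ?_ fun x => ?_
  · rw [IsHermitian, conjTranspose_eq_transpose_of_trivial, transpose_add, transpose_smul,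
      diagonal_transpose, hM]
  set q := ∑ k, v k * x k ^ 2 with hq
  have hterm : ∀ k, v k * x k ^ 2 ≤ q := fun k =>
    Finset.single_le_sum (f := fun k => v k * x k ^ 2)
      (fun k _ => mul_nonneg (hv k) (sq_nonneg _)) (Finset.mem_univ k)
  have hq0 : 0 ≤ q := Finset.sum_nonneg fun k _ => mul_nonneg (hv k) (sq_nonneg _)
  have hsq : ∀ k, 0 < v k → x k ^ 2 ≤ (v k)⁻¹ * q := fun k hk => by
    rw [inv_mul_eq_div, le_div_iff₀ hk, mul_comm]; exact hterm k
  have hentry : ∀ i j, |x i * M i j * x j| ≤ c i j * q := fun i j => by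
    by_cases h : M i j = 0
    · simp [h, hc]
    · have hi := hsq i (hsupp i j h)
      have hj := hsq j (hsupp j i (by rwa [hM.apply]))
      have hxy : |x i| * |x j| ≤ ((v i)⁻¹ + (v j)⁻¹) * q := by
        have h2 := two_mul_le_add_sq |x i| |x j|
        rw [sq_abs, sq_abs] at h2
        have := mul_nonneg (abs_nonneg (x i)) (abs_nonneg (x j))
        linarith
      calc |x i * M i j * x j| = |M i j| * (|x i| * |x j|) := by
            rw [abs_mul, abs_mul]; ring
        _ ≤ |M i j| * (((v i)⁻¹ + (v j)⁻¹) * q) :=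
            mul_le_mul_of_nonneg_left hxy (abs_nonneg _)
        _ = c i j * q := by rw [hc]; ring
  have hform : |∑ i, ∑ j, x i * M i j * x j| ≤ K * q := by
    rw [hKdef, Finset.sum_mul]
    refine (Finset.abs_sum_le_sum_abs _ _).trans (Finset.sum_le_sum fun i _ => ?_)
    rw [Finset.sum_mul]
    exact (Finset.abs_sum_le_sum_abs _ _).trans (Finset.sum_le_sum fun j _ => hentry i j)
  have hexp : star x ⬝ᵥ ((diagonal v + t • M) *ᵥ x) =
      q + t * ∑ i, ∑ j, x i * M i j * x j := by
    rw [add_mulVec, dotProduct_add, smul_mulVec, dotProduct_smul, smul_eq_mul]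
    congr 1
    · simp only [dotProduct, mulVec_diagonal, star_trivial, hq]
      exact Finset.sum_congr rfl fun k _ => by ring
    · congr 1
      simp only [dotProduct, mulVec, star_trivial, Finset.mul_sum]
      exact Finset.sum_congr rfl fun i _ => Finset.sum_congr rfl fun j _ => by ring
  have hsmall : |t * ∑ i, ∑ j, x i * M i j * x j| ≤ q := by
    rw [abs_mul]
    calc _ ≤ (K + 1)⁻¹ * (K * q) := mul_le_mul ht hform (abs_nonneg _) (by positivity)
      _ = K / (K + 1) * q := by ring
      _ ≤ 1 * q := mul_le_mul_of_nonneg_right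
          ((div_le_one (by positivity)).2 (by linarith)) hq0
      _ = q := one_mul q
  rw [hexp]
  linarith [neg_abs_le (t * ∑ i, ∑ j, x i * M i j * x j)]

/-- The symmetric matrix supported on `S × S` whose entries are given by a function on unordered
pairs of elements of `S`. -/
noncomputable def Matrix.ofSym2 {ι : Type*} (S : Set ι) : (Sym2 S → ℝ) →ₗ[ℝ] Matrix ι ι ℝ :=
  open Classical in
  { toFun := fun w => of fun i j =>
      if h : i ∈ S ∧ j ∈ S then w s(⟨i, h.1⟩, ⟨j, h.2⟩) else 0
    map_add' := fun w w' => by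
      ext i j
      simp only [of_apply, add_apply, Pi.add_apply]
      split_ifs <;> simp
    map_smul' := fun a w => by
      ext i j
      simp only [of_apply, smul_apply, Pi.smul_apply, RingHom.id_apply]
      split_ifs <;> simp }

theorem Matrix.ofSym2_apply_mk {ι : Type*} {S : Set ι} (w : Sym2 S → ℝ) (i j : S) :
    ofSym2 S w i j = w s(i, j) := by
  simp [ofSym2]

theorem Matrix.ofSym2_apply_of_notMem {ι : Type*} {S : Set ι} (w : Sym2 S → ℝ) {i : ι}
    (hi : i ∉ S) (j : ι) : ofSym2 S w i j = 0 := by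
  simp [ofSym2, hi]

theorem Matrix.isSymm_ofSym2 {ι : Type*} {S : Set ι} (w : Sym2 S → ℝ) :
    (ofSym2 S w).IsSymm := by
  ext i j
  by_cases hi : i ∈ S
  · by_cases hj : j ∈ S
    · simp only [transpose_apply]
      exact (ofSym2_apply_mk w ⟨j, hj⟩ ⟨i, hi⟩).trans
        ((congrArg w Sym2.eq_swap).trans (ofSym2_apply_mk w ⟨i, hi⟩ ⟨j, hj⟩).symm)
    · simp [ofSym2, hj]
  · simp [ofSym2, hi]

theorem Matrix.ofSym2_injective {ι : Type*} (S : Set ι) : Function.Injective (ofSym2 S) := by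
  intro w w' h
  funext z
  induction z using Sym2.ind with
  | _ i j => rw [← ofSym2_apply_mk w, ← ofSym2_apply_mk w', h]

/-- A linear map into a space of dimension less than `|S| (|S| + 1) / 2` kills a nonzero symmetric
matrix supported on `S × S`. -/
theorem Matrix.exists_isSymm_ne_zero_map_eq_zero {ι V : Type*} [Finite ι] [AddCommGroup V]
    [Module ℝ V] [FiniteDimensional ℝ V] (S : Set ι) (f : Matrix ι ι ℝ →ₗ[ℝ] V)
    (hV : Module.finrank ℝ V < (S.ncard + 1).choose 2) :
    ∃ M : Matrix ι ι ℝ, M ≠ 0 ∧ M.IsSymm ∧ (∀ i j, M i j ≠ 0 → i ∈ S) ∧ f M = 0 := by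
  classical
  have := Fintype.ofFinite S
  have hdim : Module.finrank ℝ (Sym2 S → ℝ) = (S.ncard + 1).choose 2 := by
    rw [Module.finrank_fintype_fun_eq_card, Sym2.card, ← Nat.card_eq_fintype_card,
      Nat.card_coe_set_eq]
  obtain ⟨w, hw, hw0⟩ := (Submodule.ne_bot_iff _).1
    (LinearMap.ker_ne_bot_of_finrank_lt (f := f ∘ₗ ofSym2 S) (hdim ▸ hV))
  refine ⟨ofSym2 S w, ?_, isSymm_ofSym2 w, ?_, hw⟩
  · rwa [Ne, map_eq_zero_iff _ (ofSym2_injective S)]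
  · intro i j h
    by_contra hi
    exact h (ofSym2_apply_of_notMem w hi j)

/-- Given a linear map into a space of dimension less than `r (r + 1) / 2`, where `r` is the number
of eigenvalues of `X` strictly between `0` and `1`, there is a nonzero direction in its kernel along
which `X` can be moved both ways inside `0 ⪯ X ⪯ 1`. -/
theorem Matrix.PosSemidef.exists_direction {ι V : Type*} [Fintype ι] [DecidableEq ι]
    [AddCommGroup V] [Module ℝ V] [FiniteDimensional ℝ V] {X : Matrix ι ι ℝ}
    (h0 : X.PosSemidef) (h1 : (1 - X).PosSemidef) (hX : X.IsHermitian)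
    (f : Matrix ι ι ℝ →ₗ[ℝ] V)
    (hV : Module.finrank ℝ V <
      ({i | 0 < hX.eigenvalues i ∧ hX.eigenvalues i < 1}.ncard + 1).choose 2) :
    ∃ N : Matrix ι ι ℝ, N ≠ 0 ∧ f N = 0 ∧
      (X + N).PosSemidef ∧ (1 - (X + N)).PosSemidef ∧
      (X - N).PosSemidef ∧ (1 - (X - N)).PosSemidef := by
  set S := {i | 0 < hX.eigenvalues i ∧ hX.eigenvalues i < 1}
  let U : Matrix ι ι ℝ := ↑hX.eigenvectorUnitary
  have hUU : U * Uᴴ = 1 := Unitary.mul_star_self_of_mem hX.eigenvectorUnitary.2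
  have hUU' : Uᴴ * U = 1 := Unitary.star_mul_self_of_mem hX.eigenvectorUnitary.2
  have hspec : X = U * diagonal hX.eigenvalues * Uᴴ := by
    exact hX.spectral_theorem.trans (Unitary.conjStarAlgAut_apply _ _)
  have hspec1 : 1 - X = U * diagonal (fun i => 1 - hX.eigenvalues i) * Uᴴ := by
    conv_lhs => rw [hspec, ← hUU]
    rw [← diagonal_sub, diagonal_one, mul_sub, sub_mul, mul_one]
  have hv0 : ∀ i, 0 ≤ hX.eigenvalues i := h0.eigenvalues_nonneg
  have hv1 : ∀ i, 0 ≤ 1 - hX.eigenvalues i := by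
    have hdiag : (diagonal fun i => 1 - hX.eigenvalues i).PosSemidef := by
      have := h1.conjTranspose_mul_mul_same U
      rwa [hspec1, show Uᴴ * (U * diagonal (fun i => 1 - hX.eigenvalues i) * Uᴴ) * U =
        (Uᴴ * U) * diagonal (fun i => 1 - hX.eigenvalues i) * (Uᴴ * U) by
          simp only [Matrix.mul_assoc], hUU', one_mul, mul_one] at this
    exact posSemidef_diagonal_iff.1 hdiag
  let conj : Matrix ι ι ℝ →ₗ[ℝ] Matrix ι ι ℝ :=
    LinearMap.mulRight ℝ Uᴴ ∘ₗ LinearMap.mulLeft ℝ U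
  have hconj : ∀ M, conj M = U * M * Uᴴ := fun M => rfl
  obtain ⟨M, hM0, hMs, hsupp, hfM⟩ := exists_isSymm_ne_zero_map_eq_zero S (f ∘ₗ conj) hV
  obtain ⟨ε, hε, H⟩ := exists_posSemidef_diagonal_add_smul hv0 hMs fun i j h => (hsupp i j h).1
  obtain ⟨ε', hε', H'⟩ := exists_posSemidef_diagonal_add_smul hv1 hMs
    fun i j h => sub_pos.2 (hsupp i j h).2
  set t := min ε ε'
  have ht0 : 0 < t := lt_min hε hε'
  have habs : |t| = t := abs_of_pos ht0
  have hpos : ∀ s : ℝ, |s| ≤ t →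
      (X + s • conj M).PosSemidef ∧ (1 - (X + s • conj M)).PosSemidef := by
    intro s hs
    constructor
    · have := (H s (hs.trans (min_le_left _ _))).mul_mul_conjTranspose_same U
      rw [mul_add, add_mul, ← hspec] at this
      simpa [hconj] using this
    · have hs' : |-s| ≤ ε' := (abs_neg s).trans_le (hs.trans (min_le_right _ _))
      have := (H' (-s) hs').mul_mul_conjTranspose_same U
      rw [mul_add, add_mul, ← hspec1] at this
      rw [← sub_sub, sub_eq_add_neg (1 - X)]
      simpa [hconj] using this
  refine ⟨t • conj M, ?_, ?_, (hpos t habs.le).1, (hpos t habs.le).2, ?_, ?_⟩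
  · refine smul_ne_zero ht0.ne' fun h => hM0 ?_
    calc M = (Uᴴ * U) * M * (Uᴴ * U) := by rw [hUU', one_mul, mul_one]
      _ = Uᴴ * (U * M * Uᴴ) * U := by simp only [Matrix.mul_assoc]
      _ = 0 := by rw [← hconj, h]; simp
  · rw [map_smul]
    exact (congrArg (t • ·) hfM).trans (smul_zero t)
  · rw [sub_eq_add_neg, ← neg_smul]
    exact (hpos (-t) (by rw [abs_neg, habs])).1
  · rw [sub_eq_add_neg X, ← neg_smul]
    exact (hpos (-t) (by rw [abs_neg, habs])).2

/-- Any extreme point of the set of optimal solutions of the SDP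
has at most `√(2m + 9/4) − 1/2` eigenvalues strictly between 0 and 1; in
particular at most `⌊√(2m)⌋ + 1` such fractional eigenvalues. -/
theorem stmt1 {n m d : ℕ} (hn : 0 < n) (hm : 0 < m) (hd : 0 < d) (hdn : d ≤ n)
    (C : Matrix (Fin n) (Fin n) ℝ) (A : Fin m → Matrix (Fin n) (Fin n) ℝ)
    (b : Fin m → ℝ) (rel : Fin m → ℝ → ℝ → Prop)
    (hrel : ∀ i, rel i = (· ≤ ·) ∨ rel i = (· ≥ ·) ∨ rel i = (· = ·))
    (Feas : Set (Matrix (Fin n) (Fin n) ℝ))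
    (hFeas : Feas = {X | X.IsSymm ∧ (∀ i, rel i ((A i)ᵀ * X).trace (b i)) ∧
      X.trace ≤ (d : ℝ) ∧ X.PosSemidef ∧ ((1 : Matrix (Fin n) (Fin n) ℝ) - X).PosSemidef})
    (hne : Feas.Nonempty)
    (Opt : Set (Matrix (Fin n) (Fin n) ℝ))
    (hOpt : Opt = {X ∈ Feas | ∀ Y ∈ Feas, (Cᵀ * X).trace ≤ (Cᵀ * Y).trace})
    (hatt : Opt.Nonempty) :
    ∀ X ∈ Opt.extremePoints ℝ, ∀ hX : X.IsHermitian,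
      (({i : Fin n | 0 < hX.eigenvalues i ∧ hX.eigenvalues i < 1}.ncard : ℝ) ≤
        Real.sqrt (2 * (m : ℝ) + 9 / 4) - 1 / 2) ∧
      {i : Fin n | 0 < hX.eigenvalues i ∧ hX.eigenvalues i < 1}.ncard ≤
        ⌊Real.sqrt (2 * (m : ℝ))⌋₊ + 1 := by
  intro X hXext hX
  set r := {i : Fin n | 0 < hX.eigenvalues i ∧ hX.eigenvalues i < 1}.ncard
  have hcount : (r + 1).choose 2 ≤ m + 1 := by
    by_contra! hlt
    let ip : Matrix (Fin n) (Fin n) ℝ → Matrix (Fin n) (Fin n) ℝ →ₗ[ℝ] ℝ := fun B =>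
      traceLinearMap (Fin n) ℝ ℝ ∘ₗ LinearMap.mulLeft ℝ Bᵀ
    let f : Matrix (Fin n) (Fin n) ℝ →ₗ[ℝ] (Fin m → ℝ) × ℝ :=
      (LinearMap.pi fun i => ip (A i)).prod (traceLinearMap (Fin n) ℝ ℝ)
    obtain ⟨hXOpt, hXseg⟩ := mem_extremePoints.1 hXext
    have hXOpt' := hXOpt
    rw [hOpt, Set.mem_ofPred_eq] at hXOpt'
    obtain ⟨hXF, hXmin⟩ := hXOpt'
    have hXF' := hXF
    rw [hFeas] at hXF'
    obtain ⟨-, hXA, hXtr, hX0, hX1⟩ := hXF'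
    obtain ⟨N, hN, hfN, hp0, hp1, hm0, hm1⟩ := hX0.exists_direction hX1 hX f (by simpa using hlt)
    have hNA : ∀ i, ((A i)ᵀ * N).trace = 0 := fun i => congrFun (congrArg Prod.fst hfN) i
    have hNtr : N.trace = 0 := congrArg Prod.snd hfN
    have hpF : X + N ∈ Feas := by
      rw [hFeas]
      refine ⟨hp0.1, fun i => ?_, ?_, hp0, hp1⟩
      · simpa [mul_add, hNA i] using hXA i
      · simpa [hNtr] using hXtr
    have hmF : X - N ∈ Feas := by
      rw [hFeas]
      refine ⟨hm0.1, fun i => ?_, ?_, hm0, hm1⟩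
      · simpa [mul_sub, hNA i] using hXA i
      · simpa [hNtr] using hXtr
    have hCN : (Cᵀ * N).trace = 0 := by
      have hp := hXmin _ hpF
      have hm := hXmin _ hmF
      rw [mul_add, trace_add] at hp
      rw [mul_sub, trace_sub] at hm
      linarith
    have hpO : X + N ∈ Opt := by
      rw [hOpt]
      exact ⟨hpF, fun Y hY => by simpa [mul_add, hCN] using hXmin Y hY⟩
    have hmO : X - N ∈ Opt := by
      rw [hOpt]
      exact ⟨hmF, fun Y hY => by simpa [mul_sub, hCN] using hXmin Y hY⟩
    have hseg : X ∈ openSegment ℝ (X + N) (X - N) :=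
      ⟨1 / 2, 1 / 2, by norm_num, by norm_num, by norm_num, by module⟩
    exact hN (by simpa using (hXseg _ hpO _ hmO hseg).1)
  have hquad : r * (r + 1) ≤ 2 * m + 2 := by
    have h2 : (r + 1) * r = (r + 1).choose 2 * 2 := by
      simpa using Nat.add_one_mul_choose_eq r 1
    nlinarith
  have hquadR : (r : ℝ) * (r + 1) ≤ 2 * m + 2 := by exact_mod_cast hquad
  constructor
  · rw [le_sub_iff_add_le]
    exact Real.le_sqrt_of_sq_le (by nlinarith)
  · by_contra! hlt
    have hfloor := Nat.lt_floor_add_one (Real.sqrt (2 * (m : ℝ)))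
    have hltR : ((⌊Real.sqrt (2 * (m : ℝ))⌋₊ : ℝ) + 1) + 1 ≤ r := by exact_mod_cast hlt
    have hs : Real.sqrt (2 * (m : ℝ)) < r - 1 := by linarith
    have h0 := Real.sqrt_nonneg (2 * (m : ℝ))
    have hsq := Real.sq_sqrt (show (0 : ℝ) ≤ 2 * (m : ℝ) by positivity)
    nlinarith
end

section
/- Let n, k, d be positive integers with d ≤ n, let g : ℝ^k → ℝ be a concave function that is monotone nondecreasing in at least one of its coordinates, let B_1, …, B_k be real n×n matrices and α_1, …, α_k ∈ ℝ, and set f_i(X) := ⟨B_i, X⟩ + α_i. Then there exists a real symmetric n×n matrix X with 0 ⪯ X ⪯ I_n, tr(X) ≤ d, and rank(X) ≤ d + ⌊√(2k + 1/4) − 3/2⌋ such that g(f_1(X), …, f_k(X)) ≥ max over P ∈ P_d of g(f_1(PPᵀ), …, f_k(PPᵀ)). -/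
open Matrix

/-- The symmetric matrices `X` with `0 ⪯ X ⪯ 1` and `tr X ≤ c`. -/
def spectralBox (m : Type*) [Fintype m] [DecidableEq m] (c : ℝ) : Set (Matrix m m ℝ) :=
  {X | X.PosSemidef ∧ (1 - X).PosSemidef ∧ X.trace ≤ c}

section

variable {m : Type*} [Fintype m]

theorem isClosed_setOf_posSemidef : IsClosed {X : Matrix m m ℝ | X.PosSemidef} := by
  have h : {X : Matrix m m ℝ | X.PosSemidef} =
      {X | Xᵀ = X} ∩ ⋂ x : m → ℝ, {X | 0 ≤ x ⬝ᵥ (X *ᵥ x)} := by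
    ext X
    simp [posSemidef_iff_dotProduct_mulVec, IsHermitian]
  rw [h]
  refine (isClosed_eq (by fun_prop) continuous_id).inter (isClosed_iInter fun x => ?_)
  exact isClosed_le continuous_const (by fun_prop)

theorem abs_apply_le_one_of_posSemidef [DecidableEq m] {X : Matrix m m ℝ} (h0 : X.PosSemidef)
    (h1 : (1 - X).PosSemidef) (i j : m) : |X i j| ≤ 1 := by
  have hd : ∀ i, X i i ≤ 1 := fun i => by
    have := h1.diag_nonneg (i := i)
    simpa using this
  have hs : X j i = X i j := by
    have := congrFun (congrFun h0.1 i) j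
    simpa using this
  have key : ∀ t : ℝ, 0 ≤ X i i + t * X i j + t * (X j i + t * X j j) := fun t => by
    have := h0.dotProduct_mulVec_nonneg (Pi.single i 1 + t • Pi.single j 1)
    simp [mulVec_add, mulVec_smul, add_dotProduct] at this
    linarith
  have k1 := key 1
  have k2 := key (-1)
  rw [hs] at k1 k2
  rw [abs_le]
  constructor <;> linarith [hd i, hd j]

theorem isCompact_spectralBox [DecidableEq m] (c : ℝ) : IsCompact (spectralBox m c) := by
  have hK : IsCompact (Set.univ.pi fun _ : m => Set.univ.pi fun _ : m => Set.Icc (-1 : ℝ) 1) :=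
    isCompact_univ_pi fun _ => isCompact_univ_pi fun _ => isCompact_Icc
  refine hK.of_isClosed_subset ?_ ?_
  · exact isClosed_setOf_posSemidef.inter
      ((isClosed_setOf_posSemidef.preimage (continuous_const.sub continuous_id)).inter
        (isClosed_le (continuous_id.matrix_trace) continuous_const))
  · intro X hX i _ j _
    exact abs_le.1 (abs_apply_le_one_of_posSemidef hX.1 hX.2.1 i j)

theorem mul_transpose_mem_spectralBox [DecidableEq m] {p : Type*} [Fintype p] [DecidableEq p]
    {P : Matrix m p ℝ} (hP : Pᵀ * P = 1) : P * Pᵀ ∈ spectralBox m (Fintype.card p) := by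
  have hsa : (1 - P * Pᵀ)ᴴ = 1 - P * Pᵀ := by
    simp [conjTranspose_eq_transpose_of_trivial]
  have hid : (1 - P * Pᵀ)ᴴ * (1 - P * Pᵀ) = 1 - P * Pᵀ := by
    have h : P * Pᵀ * (P * Pᵀ) = P * Pᵀ := by
      rw [Matrix.mul_assoc, ← Matrix.mul_assoc Pᵀ, hP, Matrix.one_mul]
    rw [hsa, Matrix.mul_sub, Matrix.sub_mul, Matrix.sub_mul, h]
    simp
  refine ⟨?_, ?_, ?_⟩
  · have := posSemidef_self_mul_conjTranspose P
    rwa [conjTranspose_eq_transpose_of_trivial] at this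
  · rw [← hid]
    exact posSemidef_conjTranspose_mul_self _
  · rw [trace_mul_comm, hP, trace_one]

theorem exists_pos_forall_posSemidef_diagonal_add_smul [DecidableEq m] {v : m → ℝ}
    (hv : ∀ i, 0 ≤ v i)
    {M : Matrix m m ℝ} (hM : Mᵀ = M) (hs : ∀ i j, M i j ≠ 0 → 0 < v i ∧ 0 < v j) :
    ∃ ε > 0, ∀ s : ℝ, |s| ≤ ε → (diagonal v + s • M).PosSemidef := by
  obtain ⟨δ, hδ, hδv⟩ : ∃ δ > 0, ∀ i, 0 < v i → δ ≤ v i := by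
    by_cases hne : (Finset.univ.filter fun i => 0 < v i).Nonempty
    · obtain ⟨i, hi, hmin⟩ := Finset.exists_min_image _ v hne
      exact ⟨v i, (Finset.mem_filter.1 hi).2, fun j hj => hmin j (by simpa using hj)⟩
    · refine ⟨1, one_pos, fun i hi => (hne ⟨i, by simpa using hi⟩).elim⟩
  set C : ℝ := ∑ i, ∑ j, |M i j| with hC
  have hC0 : 0 ≤ C := Finset.sum_nonneg fun i _ => Finset.sum_nonneg fun j _ => abs_nonneg _
  refine ⟨δ / (C + 1), by positivity, fun s hsε => .of_dotProduct_mulVec_nonneg ?_ fun x => ?_⟩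
  · rw [IsHermitian, conjTranspose_eq_transpose_of_trivial]
    simp [hM]
  set Q : ℝ := ∑ i, v i * x i ^ 2 with hQ
  have hQ0 : ∀ i, v i * x i ^ 2 ≤ Q := fun i =>
    Finset.single_le_sum (f := fun i => v i * x i ^ 2)
      (fun j _ => mul_nonneg (hv j) (sq_nonneg _)) (Finset.mem_univ i)
  have hQn : 0 ≤ Q := Finset.sum_nonneg fun j _ => mul_nonneg (hv j) (sq_nonneg _)
  have hterm : ∀ i j, δ * |x i * (M i j * x j)| ≤ |M i j| * Q := fun i j => by
    by_cases h : M i j = 0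
    · simp [h]
    obtain ⟨hi, hj⟩ := hs i j h
    have e : |x i * (M i j * x j)| = |M i j| * (|x i| * |x j|) := by
      rw [abs_mul, abs_mul]; ring
    have b1 : δ * x i ^ 2 ≤ Q :=
      (mul_le_mul_of_nonneg_right (hδv i hi) (sq_nonneg _)).trans (hQ0 i)
    have b2 : δ * x j ^ 2 ≤ Q :=
      (mul_le_mul_of_nonneg_right (hδv j hj) (sq_nonneg _)).trans (hQ0 j)
    have b3 : δ * (|x i| * |x j|) ≤ Q := by
      nlinarith [mul_nonneg hδ.le (sq_nonneg (|x i| - |x j|)), sq_abs (x i), sq_abs (x j)]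
    rw [e]
    nlinarith [mul_le_mul_of_nonneg_left b3 (abs_nonneg (M i j))]
  have hform : δ * |x ⬝ᵥ (M *ᵥ x)| ≤ C * Q := by
    have : |x ⬝ᵥ (M *ᵥ x)| ≤ ∑ i, ∑ j, |x i * (M i j * x j)| := by
      simp only [dotProduct, mulVec, Finset.mul_sum]
      exact (Finset.abs_sum_le_sum_abs _ _).trans
        (Finset.sum_le_sum fun i _ => Finset.abs_sum_le_sum_abs _ _)
    refine (mul_le_mul_of_nonneg_left this hδ.le).trans ?_
    simp only [hC, Finset.mul_sum, Finset.sum_mul]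
    exact Finset.sum_le_sum fun i _ => Finset.sum_le_sum fun j _ => hterm i j
  have hdiag : x ⬝ᵥ (diagonal v *ᵥ x) = Q := by
    simp only [dotProduct, mulVec_diagonal, hQ]
    exact Finset.sum_congr rfl fun i _ => by ring
  have hsx : |s * (x ⬝ᵥ (M *ᵥ x))| ≤ Q := by
    rw [abs_mul]
    rw [le_div_iff₀ (by positivity)] at hsε
    have h1 : δ * (|s| * |x ⬝ᵥ (M *ᵥ x)|) ≤ δ * Q := by
      nlinarith [mul_le_mul_of_nonneg_left hform (abs_nonneg s), abs_nonneg s,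
        mul_le_mul_of_nonneg_right hsε hQn, mul_nonneg (abs_nonneg s) hQn]
    exact le_of_mul_le_mul_left h1 hδ
  rw [star_trivial, add_mulVec, dotProduct_add, hdiag, smul_mulVec, dotProduct_smul, smul_eq_mul]
  linarith [(abs_le.1 hsx).1]

theorem exists_symm_supported_ne_zero_of_card_lt {ι : Type*} [Fintype ι] (p : m → Prop)
    [DecidablePred p] (L : Matrix m m ℝ →ₗ[ℝ] (ι → ℝ))
    (h : Fintype.card ι < (Fintype.card {i // p i} + 1).choose 2) :
    ∃ M : Matrix m m ℝ, M ≠ 0 ∧ Mᵀ = M ∧ (∀ i j, M i j ≠ 0 → p i ∧ p j) ∧ L M = 0 := by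
  let E : (Sym2 {i // p i} → ℝ) →ₗ[ℝ] Matrix m m ℝ :=
    { toFun := fun y => Matrix.of fun i j =>
        if hij : p i ∧ p j then y s(⟨i, hij.1⟩, ⟨j, hij.2⟩) else 0
      map_add' := fun y z => by
        ext i j
        by_cases hij : p i ∧ p j <;> simp [hij]
      map_smul' := fun c y => by
        ext i j
        by_cases hij : p i ∧ p j <;> simp [hij] }
  have hker : LinearMap.ker (L ∘ₗ E) ≠ ⊥ := by
    apply LinearMap.ker_ne_bot_of_finrank_lt
    rwa [Module.finrank_fintype_fun_eq_card, Module.finrank_fintype_fun_eq_card, Sym2.card]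
  obtain ⟨y, hy, hy0⟩ := Submodule.exists_mem_ne_zero_of_ne_bot hker
  refine ⟨E y, fun h0 => hy0 ?_, ?_, fun i j hij => ?_, hy⟩
  · funext z
    induction z using Sym2.ind with
    | _ a b =>
      have := congrFun (congrFun h0 a) b
      simpa [E, a.2, b.2] using this
  · ext i j
    by_cases hij : p i ∧ p j
    · simp [E, hij, Sym2.eq_swap]
    · have hji : ¬ (p j ∧ p i) := fun h => hij h.symm
      simp [E, hij, hji]
  · by_contra hp
    exact hij (by simp [E, hp])

/-- If the number of eigenvalues of `X` in the open unit interval is large compared with the number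
of linear constraints, then `X` is the midpoint of a segment in `{0 ⪯ X ⪯ 1}` along which the
constraints are constant. -/
theorem exists_perturbation_of_card_lt [DecidableEq m] {ι : Type*} [Fintype ι] {X : Matrix m m ℝ}
    (h0 : X.PosSemidef) (hX1 : ∀ i, h0.1.eigenvalues i ≤ 1)
    (L : Matrix m m ℝ →ₗ[ℝ] (ι → ℝ))
    (h : Fintype.card ι <
      (Fintype.card {i // 0 < h0.1.eigenvalues i ∧ h0.1.eigenvalues i < 1} + 1).choose 2) :
    ∃ N : Matrix m m ℝ, N ≠ 0 ∧ L N = 0 ∧ (X + N).PosSemidef ∧ (1 - (X + N)).PosSemidef ∧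
      (X - N).PosSemidef ∧ (1 - (X - N)).PosSemidef := by
  set v := h0.1.eigenvalues with hv
  set U : Matrix m m ℝ := (h0.1.eigenvectorUnitary : Matrix m m ℝ) with hU
  have hUU : U * Uᴴ = 1 := Unitary.coe_mul_star_self h0.1.eigenvectorUnitary
  have hUU' : Uᴴ * U = 1 := Unitary.coe_star_mul_self h0.1.eigenvectorUnitary
  have hX : X = U * diagonal v * Uᴴ := by
    have := h0.1.spectral_theorem
    rw [Unitary.conjStarAlgAut_apply] at this
    exact this
  let T : Matrix m m ℝ →ₗ[ℝ] Matrix m m ℝ :=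
    LinearMap.mulRight ℝ Uᴴ ∘ₗ LinearMap.mulLeft ℝ U
  have hT : ∀ M, T M = U * M * Uᴴ := fun M => rfl
  obtain ⟨M, hM0, hMs, hMp, hLM⟩ := exists_symm_supported_ne_zero_of_card_lt
    (fun i => 0 < v i ∧ v i < 1) (L ∘ₗ T) h
  obtain ⟨ε, hε, hεM⟩ := exists_pos_forall_posSemidef_diagonal_add_smul (v := v)
    h0.eigenvalues_nonneg hMs fun i j hij => ⟨(hMp i j hij).1.1, (hMp i j hij).2.1⟩
  obtain ⟨η, hη, hηM⟩ := exists_pos_forall_posSemidef_diagonal_add_smul (v := fun i => 1 - v i)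
    (fun i => sub_nonneg.2 (hX1 i)) hMs fun i j hij =>
      ⟨sub_pos.2 (hMp i j hij).1.2, sub_pos.2 (hMp i j hij).2.2⟩
  have hdiag : diagonal (fun i => 1 - v i) = (1 : Matrix m m ℝ) - diagonal v := by
    rw [← diagonal_one, diagonal_sub]
  set s := min ε η with hs
  have hs0 : 0 < s := lt_min hε hη
  have low : ∀ t : ℝ, |t| = s → (X + t • T M).PosSemidef := fun t ht => by
    have := (hεM t (ht.trans_le (min_le_left _ _))).mul_mul_conjTranspose_same U
    rw [hX, hT]
    simpa [Matrix.mul_add, Matrix.add_mul] using this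
  have high : ∀ t : ℝ, |t| = s → (1 - (X + t • T M)).PosSemidef := fun t ht => by
    have := (hηM (-t) (by rw [abs_neg]; exact ht.trans_le (min_le_right _ _))
      ).mul_mul_conjTranspose_same U
    have e : U * (diagonal (fun i => 1 - v i) + -t • M) * Uᴴ = 1 - (X + t • T M) := by
      rw [hX, hT, hdiag]
      simp only [Matrix.mul_add, Matrix.add_mul, Matrix.mul_sub, Matrix.sub_mul, Matrix.mul_one,
        hUU, Matrix.mul_smul, Matrix.smul_mul, neg_smul,
        Matrix.mul_neg, Matrix.neg_mul]
      abel
    rwa [e] at this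
  have hpos : |s| = s := abs_of_pos hs0
  have hneg : |-s| = s := by rw [abs_neg, hpos]
  refine ⟨s • T M, ?_, ?_, low s hpos, high s hpos, ?_, ?_⟩
  · rw [smul_ne_zero_iff]
    refine ⟨hs0.ne', fun h => hM0 ?_⟩
    have : Uᴴ * T M * U = M := by
      rw [hT, Matrix.mul_assoc, Matrix.mul_assoc, hUU', Matrix.mul_one, ← Matrix.mul_assoc, hUU',
        Matrix.one_mul]
    rw [← this, h]
    simp
  · rw [map_smul, show L (T M) = 0 from hLM, smul_zero]
  · simpa [sub_eq_add_neg] using low (-s) hneg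
  · simpa [sub_eq_add_neg] using high (-s) hneg

theorem eigenvalues_le_one_of_posSemidef_one_sub [DecidableEq m] {X : Matrix m m ℝ}
    (hX : X.IsHermitian) (h1 : (1 - X).PosSemidef) (i : m) : hX.eigenvalues i ≤ 1 := by
  set U : Matrix m m ℝ := (hX.eigenvectorUnitary : Matrix m m ℝ) with hU
  have hUU' : Uᴴ * U = 1 := Unitary.coe_star_mul_self hX.eigenvectorUnitary
  have hD : X = U * diagonal hX.eigenvalues * Uᴴ := by
    have := hX.spectral_theorem
    rw [Unitary.conjStarAlgAut_apply] at this
    exact this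
  have e : Uᴴ * (1 - X) * U = diagonal (fun i => 1 - hX.eigenvalues i) := by
    rw [← diagonal_sub, diagonal_one, Matrix.mul_sub, Matrix.sub_mul, Matrix.mul_one, hUU']
    congr 1
    conv_lhs => rw [hD]
    simp only [← Matrix.mul_assoc]
    rw [hUU', Matrix.one_mul, Matrix.mul_assoc, hUU', Matrix.mul_one]
  have := h1.conjTranspose_mul_mul_same U
  rw [e, posSemidef_diagonal_iff] at this
  linarith [this i]

theorem rank_le_of_card_eigenvalues_lt_one [DecidableEq m] {X : Matrix m m ℝ} {d r : ℕ}
    (h0 : X.PosSemidef) (hX1 : ∀ i, h0.1.eigenvalues i ≤ 1) (htr : X.trace ≤ d)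
    (hr : Fintype.card {i // 0 < h0.1.eigenvalues i ∧ h0.1.eigenvalues i < 1} ≤ r + 1) :
    X.rank ≤ d + r := by
  set v := h0.1.eigenvalues with hv
  have hv0 : ∀ i, 0 ≤ v i := h0.eigenvalues_nonneg
  rw [h0.1.rank_eq_card_non_zero_eigs]
  rw [Fintype.card_subtype] at hr ⊢
  set F := Finset.univ.filter fun i => 0 < v i ∧ v i < 1 with hF
  set O := Finset.univ.filter fun i => v i = 1 with hO
  have hdisj : Disjoint F O := by
    rw [Finset.disjoint_filter]
    intro i _ hi h
    linarith [hi.2]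
  have hunion : Finset.univ.filter (fun i => v i ≠ 0) = F ∪ O := by
    ext i
    simp only [hF, hO, Finset.mem_filter, Finset.mem_univ, true_and, Finset.mem_union]
    constructor
    · intro h
      rcases (hX1 i).lt_or_eq with h' | h'
      · exact Or.inl ⟨(hv0 i).lt_of_ne' h, h'⟩
      · exact Or.inr h'
    · rintro (h | h)
      · exact h.1.ne'
      · rw [h]; exact one_ne_zero
  have htrace : X.trace = ∑ i, v i := by
    have := h0.1.trace_eq_sum_eigenvalues
    simpa using this
  have hsum : ∑ i ∈ F, v i + O.card ≤ d := by
    have h1 : ∑ i ∈ O, v i = O.card := by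
      rw [Finset.sum_congr rfl (fun i hi => (Finset.mem_filter.1 hi).2), Finset.sum_const,
        nsmul_eq_mul, mul_one]
    rw [← h1, ← Finset.sum_union hdisj]
    refine (Finset.sum_le_univ_sum_of_nonneg hv0).trans ?_
    rwa [← htrace]
  rw [hunion, Finset.card_union_of_disjoint hdisj]
  rcases F.eq_empty_or_nonempty with hFe | hFn
  · rw [hFe] at hsum ⊢
    simp only [Finset.sum_empty, zero_add, Nat.cast_le] at hsum
    simp only [Finset.card_empty, zero_add]
    omega
  · have : 0 < ∑ i ∈ F, v i := Finset.sum_pos (fun i hi => (Finset.mem_filter.1 hi).2.1) hFn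
    have hlt : (O.card : ℝ) < d := by linarith
    have := Nat.cast_lt.1 hlt
    omega

theorem le_floor_sqrt_add_one_of_choose_le {l k : ℕ} (h : (l + 1).choose 2 ≤ k) :
    l ≤ ⌊Real.sqrt (2 * (k : ℝ) + 1 / 4) - 3 / 2⌋₊ + 1 := by
  rcases Nat.eq_zero_or_pos l with rfl | hl
  · omega
  have hR : ((l : ℝ) + 1) * l / 2 ≤ k := by
    have : (((l + 1).choose 2 : ℕ) : ℝ) ≤ k := by exact_mod_cast h
    rw [Nat.cast_choose_two] at this
    push_cast at this
    linarith
  have hs : (l : ℝ) + 1 / 2 ≤ Real.sqrt (2 * (k : ℝ) + 1 / 4) := by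
    apply Real.le_sqrt_of_sq_le
    nlinarith
  have : l - 1 ≤ ⌊Real.sqrt (2 * (k : ℝ) + 1 / 4) - 3 / 2⌋₊ := by
    apply Nat.le_floor
    rw [Nat.cast_sub hl]
    push_cast
    linarith
  omega

/-- A nonempty compact set of matrices contains a matrix that is not the midpoint of any
nondegenerate segment with endpoints in the set. -/
theorem exists_mem_forall_add_sub_mem_eq_zero {S : Set (Matrix m m ℝ)} (hS : IsCompact S)
    (hne : S.Nonempty) : ∃ X ∈ S, ∀ N, X + N ∈ S → X - N ∈ S → N = 0 := by
  obtain ⟨X, hX, hmax⟩ := hS.exists_isMaxOn hne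
    (f := fun X : Matrix m m ℝ => (Xᵀ * X).trace) (by fun_prop)
  refine ⟨X, hX, fun N hp hm => ?_⟩
  have h1 : ((X + N)ᵀ * (X + N)).trace ≤ (Xᵀ * X).trace := hmax hp
  have h2 : ((X - N)ᵀ * (X - N)).trace ≤ (Xᵀ * X).trace := hmax hm
  simp only [transpose_add, transpose_sub, Matrix.mul_add, Matrix.add_mul, Matrix.mul_sub,
    Matrix.sub_mul, trace_add, trace_sub] at h1 h2
  have h3 : 0 ≤ (Nᵀ * N).trace := by
    have := (posSemidef_conjTranspose_mul_self N).trace_nonneg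
    rwa [conjTranspose_eq_transpose_of_trivial] at this
  have h4 : (Nᴴ * N).trace = 0 := by
    rw [conjTranspose_eq_transpose_of_trivial]
    linarith
  exact trace_conjTranspose_mul_self_eq_zero_iff.1 h4

end

/-- For concave `g` monotone nondecreasing in at least one
coordinate and affine `f_i(X) = ⟨B_i, X⟩ + α_i`, there is a solution `X` with
`0 ⪯ X ⪯ I`, `tr X ≤ d` and `rank X ≤ d + ⌊√(2k + 1/4) − 3/2⌋` whose objective
value is at least that of any `d`-dimensional projection `P P^T`. -/
theorem stmt3 {n k d : ℕ} (hn : 0 < n) (hk : 0 < k) (hd : 0 < d) (hdn : d ≤ n)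
    (g : (Fin k → ℝ) → ℝ) (hconc : ConcaveOn ℝ Set.univ g)
    (hmono : ∃ j : Fin k, ∀ x : Fin k → ℝ, ∀ s t : ℝ, s ≤ t →
      g (Function.update x j s) ≤ g (Function.update x j t))
    (B : Fin k → Matrix (Fin n) (Fin n) ℝ) (α : Fin k → ℝ) :
    ∃ X : Matrix (Fin n) (Fin n) ℝ, X.IsSymm ∧ X.PosSemidef ∧
      ((1 : Matrix (Fin n) (Fin n) ℝ) - X).PosSemidef ∧ X.trace ≤ (d : ℝ) ∧
      X.rank ≤ d + ⌊Real.sqrt (2 * (k : ℝ) + 1 / 4) - 3 / 2⌋₊ ∧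
      ∀ P : Matrix (Fin n) (Fin d) ℝ, Pᵀ * P = 1 →
        g (fun i => ((B i)ᵀ * (P * Pᵀ)).trace + α i) ≤
          g (fun i => ((B i)ᵀ * X).trace + α i) := by
  obtain ⟨j, hj⟩ := hmono
  have hg : Continuous g := hconc.locallyLipschitz.continuous
  set K := spectralBox (Fin n) (d : ℝ) with hKdef
  have hK : IsCompact K := isCompact_spectralBox _
  have hKne : K.Nonempty := ⟨0, .zero, by simpa using PosSemidef.one, by simp⟩
  obtain ⟨Z, hZK, hZ⟩ := hK.exists_isMaxOn hKne
    (f := fun X => g (fun i => ((B i)ᵀ * X).trace + α i))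
    (by
      refine (hg.comp (continuous_pi fun i => ?_)).continuousOn
      fun_prop)
  set S₀ := K ∩ ⋂ i, {X | i ≠ j → ((B i)ᵀ * X).trace = ((B i)ᵀ * Z).trace} with hS₀
  have hS₀c : IsCompact S₀ := by
    refine hK.inter_right (isClosed_iInter fun i => ?_)
    by_cases hij : i = j
    · simp [hij]
    · simp only [ne_eq, hij, not_false_eq_true, true_imp_iff]
      exact isClosed_eq (by fun_prop) continuous_const
  obtain ⟨W, hWS, hW⟩ := hS₀c.exists_isMaxOn ⟨Z, hZK, by simp⟩
    (f := fun X => ((B j)ᵀ * X).trace) (by fun_prop)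
  obtain ⟨X, ⟨hXS, hXj⟩, hext⟩ := exists_mem_forall_add_sub_mem_eq_zero
    (S := S₀ ∩ {X | ((B j)ᵀ * X).trace = ((B j)ᵀ * W).trace})
    (hS₀c.inter_right (isClosed_eq (by fun_prop) continuous_const)) ⟨W, hWS, rfl⟩
  have hXj : ((B j)ᵀ * X).trace = ((B j)ᵀ * W).trace := hXj
  have hXi : ∀ i, i ≠ j → ((B i)ᵀ * X).trace = ((B i)ᵀ * Z).trace := fun i =>
    Set.mem_iInter.1 hXS.2 i
  obtain ⟨h0, h1, htr⟩ := hXS.1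
  have hX1 := eigenvalues_le_one_of_posSemidef_one_sub h0.1 h1
  refine ⟨X, by simpa [IsHermitian, IsSymm] using h0.1, h0, h1, htr, ?_, fun P hP => ?_⟩
  · refine rank_le_of_card_eigenvalues_lt_one h0 hX1 htr (le_floor_sqrt_add_one_of_choose_le ?_)
    by_contra! hlt
    let L : Matrix (Fin n) (Fin n) ℝ →ₗ[ℝ] (Fin k → ℝ) := LinearMap.pi fun i =>
      if i = j then traceLinearMap (Fin n) ℝ ℝ
      else traceLinearMap (Fin n) ℝ ℝ ∘ₗ LinearMap.mulLeft ℝ (B i)ᵀ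
    obtain ⟨N, hN0, hLN, p1, p2, q1, q2⟩ := exists_perturbation_of_card_lt h0 hX1 L
      (by simpa using hlt)
    have hNtr : N.trace = 0 := by simpa [L] using congrFun hLN j
    have hNi : ∀ i, i ≠ j → ((B i)ᵀ * N).trace = 0 := fun i hi => by
      simpa [L, hi] using congrFun hLN i
    have hp : X + N ∈ S₀ := ⟨⟨p1, p2, by rw [trace_add, hNtr, add_zero]; exact htr⟩,
      Set.mem_iInter.2 fun i hi => by
        rw [Matrix.mul_add, trace_add, hNi i hi, add_zero, hXi i hi]⟩
    have hq : X - N ∈ S₀ := ⟨⟨q1, q2, by rw [trace_sub, hNtr, sub_zero]; exact htr⟩,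
      Set.mem_iInter.2 fun i hi => by
        rw [Matrix.mul_sub, trace_sub, hNi i hi, sub_zero, hXi i hi]⟩
    have hNj : ((B j)ᵀ * N).trace = 0 := by
      have hp' : ((B j)ᵀ * (X + N)).trace ≤ ((B j)ᵀ * W).trace := hW hp
      have hq' : ((B j)ᵀ * (X - N)).trace ≤ ((B j)ᵀ * W).trace := hW hq
      rw [Matrix.mul_add, trace_add] at hp'
      rw [Matrix.mul_sub, trace_sub] at hq'
      linarith
    refine hN0 (hext N ⟨hp, ?_⟩ ⟨hq, ?_⟩)
    · change ((B j)ᵀ * (X + N)).trace = _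
      rw [Matrix.mul_add, trace_add, hNj, add_zero, hXj]
    · change ((B j)ᵀ * (X - N)).trace = _
      rw [Matrix.mul_sub, trace_sub, hNj, sub_zero, hXj]
  · have hPK : P * Pᵀ ∈ K := by simpa using mul_transpose_mem_spectralBox hP
    refine (show _ ≤ g (fun i => ((B i)ᵀ * Z).trace + α i) from hZ hPK).trans ?_
    have hZW : ((B j)ᵀ * Z).trace ≤ ((B j)ᵀ * W).trace := hW ⟨hZK, by simp⟩
    have := hj (fun i => ((B i)ᵀ * Z).trace + α i) (((B j)ᵀ * Z).trace + α j)
      (((B j)ᵀ * X).trace + α j) (by rw [hXj]; linarith)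
    rw [Function.update_eq_self] at this
    have e : (fun i => ((B i)ᵀ * X).trace + α i) =
        Function.update (fun i => ((B i)ᵀ * Z).trace + α i) j (((B j)ᵀ * X).trace + α j) := by
      funext i
      by_cases hi : i = j
      · subst hi; simp
      · simp [hi, hXi i hi]
    rwa [e]
end
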